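/- arXiv:2310.09128 — 2 statements merged into one kernel-verified Lean document; each statement's English description precedes it below -/
import Mathlib

section
/- If G is a graph, F is a set of graphs each member of which is a cycle, and y is a vertex of G of degree 0 or of degree 1, then ι(G, F) = ι(G − y, F). -/
open SimpleGraph

/-- The closed neighbourhood `N[D]` of a set `D` of vertices of `G`. -/
def closedNbhd {V : Type*} (G : SimpleGraph V) (D : Set V) : Set V :=
  D ∪ {v | ∃ u ∈ D, G.Adj u v}

/-- `G` contains a subgraph isomorphic to `H` (a copy of `H`). -/
def HasCopy {W V : Type*} (H : SimpleGraph W) (G : SimpleGraph V) : Prop :=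
  ∃ f : W ↪ V, ∀ ⦃a b⦄, H.Adj a b → G.Adj (f a) (f b)

/-- `D` is an `H`-isolating set of `G` (single graph `H`). -/
def IsIsolating {W V : Type*} (H : SimpleGraph W) (G : SimpleGraph V) (D : Set V) : Prop :=
  ¬ HasCopy H (G.induce (closedNbhd G D)ᶜ)

/-- The `H`-isolation number of `G` (single graph `H`). -/
noncomputable def isolNum {W V : Type*} (H : SimpleGraph W) (G : SimpleGraph V) : ℕ :=
  sInf {k | ∃ D : Set V, D.ncard = k ∧ IsIsolating H G D}

/-- `D` is an `F`-isolating set of `G`, for a set `F` of graphs. -/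
def IsIsolatingFam {V : Type*} (F : Set ((n : ℕ) × SimpleGraph (Fin n)))
    (G : SimpleGraph V) (D : Set V) : Prop :=
  ∀ H ∈ F, ¬ HasCopy H.2 (G.induce (closedNbhd G D)ᶜ)

/-- The `F`-isolation number of `G`, for a set `F` of graphs. -/
noncomputable def isolNumFam {V : Type*} (F : Set ((n : ℕ) × SimpleGraph (Fin n)))
    (G : SimpleGraph V) : ℕ :=
  sInf {k | ∃ D : Set V, D.ncard = k ∧ IsIsolatingFam F G D}

/-- The 4-cycle. -/
def C4 : SimpleGraph (Fin 4) := cycleGraph 4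

/-- The diamond graph: a 4-cycle together with a chord. -/
def diamondGraph : SimpleGraph (Fin 4) :=
  fromEdgeSet {s(0, 1), s(1, 2), s(2, 3), s(3, 0), s(0, 2)}

/-- The complete graph on 4 vertices. -/
def K4 : SimpleGraph (Fin 4) := ⊤

/-- `G₁`: the square of the 9-cycle. -/
def Gr1 : SimpleGraph (Fin 9) :=
  fromEdgeSet {s(0, 1), s(1, 2), s(2, 3), s(3, 4), s(4, 5), s(5, 6), s(6, 7), s(7, 8), s(8, 0),
    s(0, 2), s(1, 3), s(2, 4), s(3, 5), s(4, 6), s(5, 7), s(6, 8), s(7, 0), s(8, 1)}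

/-- `G₂`. -/
def Gr2 : SimpleGraph (Fin 9) :=
  fromEdgeSet {s(0, 1), s(0, 5), s(0, 6), s(0, 8), s(1, 2), s(1, 7), s(1, 8), s(2, 3), s(2, 6),
    s(2, 7), s(3, 4), s(3, 6), s(3, 8), s(4, 5), s(4, 7), s(4, 8), s(5, 6), s(5, 7)}

/-- `G₃`. -/
def Gr3 : SimpleGraph (Fin 9) :=
  fromEdgeSet {s(0, 1), s(0, 5), s(0, 6), s(0, 8), s(1, 2), s(1, 7), s(1, 8), s(2, 3), s(2, 7),
    s(2, 8), s(3, 4), s(3, 6), s(3, 8), s(4, 5), s(4, 6), s(4, 7), s(5, 6), s(5, 7)}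

/-- `G₄`. -/
def Gr4 : SimpleGraph (Fin 9) :=
  fromEdgeSet {s(0, 1), s(0, 2), s(0, 3), s(0, 4), s(1, 2), s(1, 5), s(1, 6), s(2, 5), s(2, 6),
    s(3, 4), s(3, 7), s(3, 8), s(4, 7), s(4, 8), s(5, 6), s(5, 8), s(6, 7), s(7, 8)}

/-- `G₅`: `G₄` with the edge `{2,3}` removed. -/
def Gr5 : SimpleGraph (Fin 9) :=
  fromEdgeSet {s(0, 1), s(0, 2), s(0, 3), s(0, 4), s(1, 5), s(1, 6), s(2, 5), s(2, 6),
    s(3, 4), s(3, 7), s(3, 8), s(4, 7), s(4, 8), s(5, 6), s(5, 8), s(6, 7), s(7, 8)}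

/-- `G₆`: `G₅` with the edge `{4,5}` removed. -/
def Gr6 : SimpleGraph (Fin 9) :=
  fromEdgeSet {s(0, 1), s(0, 2), s(0, 3), s(0, 4), s(1, 5), s(1, 6), s(2, 5), s(2, 6),
    s(3, 7), s(3, 8), s(4, 7), s(4, 8), s(5, 6), s(5, 8), s(6, 7), s(7, 8)}

/-- The set `𝒢₄ = {C₄, C₄', K₄}` of 4-vertex exceptional graphs. -/
def calG4 : Set ((n : ℕ) × SimpleGraph (Fin n)) := {⟨4, C4⟩, ⟨4, diamondGraph⟩, ⟨4, K4⟩}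

/-- The set `𝒢₉ = {G₁, …, G₆}` of 9-vertex exceptional graphs. -/
def calG9 : Set ((n : ℕ) × SimpleGraph (Fin n)) :=
  {⟨9, Gr1⟩, ⟨9, Gr2⟩, ⟨9, Gr3⟩, ⟨9, Gr4⟩, ⟨9, Gr5⟩, ⟨9, Gr6⟩}

/-- The set `ℰ₄ = 𝒢₄ ∪ 𝒢₉` of exceptional graphs. -/
def calE4 : Set ((n : ℕ) × SimpleGraph (Fin n)) := calG4 ∪ calG9

/-- Two sets of natural numbers, each of which is bounded below elementwise by members of the other,
have the same infimum. -/
lemma Nat.sInf_eq_of_forall_exists_le {S T : Set ℕ} (hST : ∀ s ∈ S, ∃ t ∈ T, t ≤ s)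
    (hTS : ∀ t ∈ T, ∃ s ∈ S, s ≤ t) : sInf S = sInf T := by
  rcases S.eq_empty_or_nonempty with rfl | hS
  · have hT : T = ∅ := Set.eq_empty_of_forall_notMem fun t ht => by simpa using hTS t ht
    rw [hT]
  · have hT : T.Nonempty := by
      obtain ⟨t, ht, -⟩ := hST _ (Nat.sInf_mem hS)
      exact ⟨t, ht⟩
    apply le_antisymm
    · obtain ⟨s, hs, hle⟩ := hTS _ (Nat.sInf_mem hT)
      exact (Nat.sInf_le hs).trans hle
    · obtain ⟨t, ht, hle⟩ := hST _ (Nat.sInf_mem hS)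
      exact (Nat.sInf_le ht).trans hle

/-- Every vertex of a cycle of length at least three has two distinct neighbours. -/
lemma SimpleGraph.cycleGraph_exists_adj_adj_ne {k : ℕ} (hk : 3 ≤ k) (a : Fin k) :
    ∃ b c, b ≠ c ∧ (cycleGraph k).Adj a b ∧ (cycleGraph k).Adj a c := by
  obtain ⟨n, rfl⟩ := Nat.exists_eq_add_of_le' hk
  have h : 1 < ((cycleGraph (n + 3)).neighborFinset a).card := by
    rw [card_neighborFinset_eq_degree, cycleGraph_degree_three_le]
    norm_num
  obtain ⟨b, hb, c, hc, hbc⟩ := Finset.one_lt_card.mp h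
  exact ⟨b, c, hbc, by simpa using hb, by simpa using hc⟩

/-- A copy of a graph in which every vertex has two distinct neighbours avoids every vertex
with at most one neighbour. -/
lemma SimpleGraph.apply_ne_of_subsingleton_neighborSet {W V : Type*} {H : SimpleGraph W}
    {G : SimpleGraph V} (hH : ∀ a, ∃ b c, b ≠ c ∧ H.Adj a b ∧ H.Adj a c) {y : V}
    (hy : (G.neighborSet y).Subsingleton) (f : W ↪ V)
    (hf : ∀ ⦃a b⦄, H.Adj a b → G.Adj (f a) (f b)) (a : W) : f a ≠ y := by
  rintro rfl
  obtain ⟨b, c, hbc, hb, hc⟩ := hH a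
  exact hbc (f.injective (hy (hf hb) (hf hc)))

lemma hasCopy_induce_iff {W V : Type*} {H : SimpleGraph W} {G : SimpleGraph V} {S : Set V} :
    HasCopy H (G.induce S) ↔
      ∃ f : W ↪ V, (∀ a, f a ∈ S) ∧ ∀ ⦃a b⦄, H.Adj a b → G.Adj (f a) (f b) := by
  constructor
  · rintro ⟨f, hf⟩
    exact ⟨f.trans (Function.Embedding.subtype _), fun a => (f a).2, fun a b hab => hf hab⟩
  · rintro ⟨f, hS, hf⟩
    exact ⟨f.codRestrict S hS, fun a b hab => hf hab⟩

/-- Isolating sets of `G − y` are isolating in `G` if no copy of a member of `F` contains `y`. -/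
lemma IsIsolatingFam.image_val {V : Type*} {G : SimpleGraph V}
    {F : Set ((n : ℕ) × SimpleGraph (Fin n))}
    (hF : ∀ H ∈ F, ∀ a, ∃ b c, b ≠ c ∧ H.2.Adj a b ∧ H.2.Adj a c) {y : V}
    (hy : (G.neighborSet y).Subsingleton) {D : Set ↥({y}ᶜ : Set V)}
    (hD : IsIsolatingFam F (G.induce {y}ᶜ) D) : IsIsolatingFam F G (Subtype.val '' D) := by
  intro H hH hcopy
  obtain ⟨f, hS, hf⟩ := hasCopy_induce_iff.mp hcopy
  have hne := apply_ne_of_subsingleton_neighborSet (hF H hH) hy f hf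
  refine hD H hH (hasCopy_induce_iff.mpr ⟨f.codRestrict _ hne, fun a ha => hS a ?_, fun a b hab =>
    hf hab⟩)
  rcases ha with ha | ⟨u, hu, hadj⟩
  · exact Or.inl ⟨_, ha, rfl⟩
  · exact Or.inr ⟨u, ⟨u, hu, rfl⟩, hadj⟩

/-- Replacing `y` by its neighbours turns an isolating set of `G` into one of `G − y`. -/
lemma IsIsolatingFam.induce_compl_singleton {V : Type*} {G : SimpleGraph V}
    {F : Set ((n : ℕ) × SimpleGraph (Fin n))} {y : V} {D : Set V} (hD : IsIsolatingFam F G D) :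
    IsIsolatingFam F (G.induce {y}ᶜ) {v | ↑v ∈ D ∨ y ∈ D ∧ G.Adj y v} := by
  intro H hH hcopy
  obtain ⟨f, hS, hf⟩ := hasCopy_induce_iff.mp hcopy
  refine hD H hH (hasCopy_induce_iff.mpr
    ⟨f.trans (Function.Embedding.subtype _), fun a ha => hS a ?_, fun a b hab => hf hab⟩)
  rcases ha with ha | ⟨u, hu, hadj⟩
  · exact Or.inl (Or.inl ha)
  · by_cases huy : u = y
    · subst huy
      exact Or.inl (Or.inr ⟨hu, hadj⟩)
    · exact Or.inr ⟨⟨u, huy⟩, Or.inl hu, hadj⟩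

lemma ncard_replace_by_neighbors_le {V : Type*} [Finite V] {G : SimpleGraph V} {y : V}
    (hy : (G.neighborSet y).ncard ≤ 1) (D : Set V) :
    {v : ↥({y}ᶜ : Set V) | ↑v ∈ D ∨ y ∈ D ∧ G.Adj y v}.ncard ≤ D.ncard := by
  rw [← Set.ncard_image_of_injective _ Subtype.val_injective]
  by_cases hyD : y ∈ D
  · calc
      _ ≤ (D \ {y} ∪ G.neighborSet y).ncard := by
        refine Set.ncard_le_ncard ?_ (Set.toFinite _)
        rintro _ ⟨v, hv | hv, rfl⟩
        · exact Or.inl ⟨hv, v.2⟩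
        · exact Or.inr hv.2
      _ ≤ (D \ {y}).ncard + (G.neighborSet y).ncard := Set.ncard_union_le _ _
      _ ≤ (D \ {y}).ncard + 1 := by gcongr
      _ = D.ncard := Set.ncard_sdiff_singleton_add_one hyD (Set.toFinite _)
  · refine Set.ncard_le_ncard ?_ (Set.toFinite _)
    rintro _ ⟨v, hv | hv, rfl⟩
    · exact hv
    · exact absurd hv.1 hyD

/-- If `𝓕` is a set of cycles and `y` is a vertex of `G` of degree `0` or `1`, then
`ι(G, 𝓕) = ι(G − y, 𝓕)`. -/
theorem stmt6 {V : Type*} [Fintype V] (G : SimpleGraph V)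
    (F : Set ((n : ℕ) × SimpleGraph (Fin n)))
    (hF : ∀ H ∈ F, ∃ k, 3 ≤ k ∧ Nonempty (H.2 ≃g cycleGraph k))
    (y : V) (hy : (G.neighborSet y).ncard = 0 ∨ (G.neighborSet y).ncard = 1) :
    isolNumFam F G = isolNumFam F (G.induce {y}ᶜ) := by
  have hcard : (G.neighborSet y).ncard ≤ 1 := by omega
  have hsub : (G.neighborSet y).Subsingleton := Set.ncard_le_one_iff_subsingleton.mp hcard
  have hF' : ∀ H ∈ F, ∀ a, ∃ b c, b ≠ c ∧ H.2.Adj a b ∧ H.2.Adj a c := by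
    intro H hH a
    obtain ⟨k, hk, ⟨e⟩⟩ := hF H hH
    obtain ⟨b, c, hbc, hb, hc⟩ := cycleGraph_exists_adj_adj_ne hk (e a)
    exact ⟨e.symm b, e.symm c, e.symm.injective.ne hbc,
      by simpa using e.symm.map_adj_iff.mpr hb, by simpa using e.symm.map_adj_iff.mpr hc⟩
  apply Nat.sInf_eq_of_forall_exists_le
  · rintro _ ⟨D, rfl, hD⟩
    exact ⟨_, ⟨_, rfl, hD.induce_compl_singleton⟩, ncard_replace_by_neighbors_le hcard D⟩
  · rintro _ ⟨D, rfl, hD⟩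
    exact ⟨_, ⟨_, rfl, hD.image_val hF' hsub⟩,
      (Set.ncard_image_of_injective _ Subtype.val_injective).le⟩
end

section
/- If n ≤ 9 and G is a connected graph on n vertices that is not an E_4-graph, then ι(G, C_4) ≤ 1. -/
open SimpleGraph

/-- `k n`, where kernel reduction evaluates `n` to a literal before entering `k`. -/
def force (n : ℕ) (k : ℕ → Bool) : Bool :=
  match n + 1 with
  | 0 => false
  | m + 1 => k m

/-- `k (l.reverse ++ acc)`, with all entries of `l` evaluated. -/
def forceList (k : List ℕ → Bool) : List ℕ → List ℕ → Bool
  | [], acc => k acc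
  | a :: l, acc => force a fun a => forceList k l (a :: acc)

/-- `k (l.reverse ++ acc)`, with all entries of `l` evaluated. -/
def forcePairs (k : List (ℕ × ℕ) → Bool) : List (ℕ × ℕ) → List (ℕ × ℕ) → Bool
  | [], acc => k acc
  | x :: l, acc => force x.1 fun a => force x.2 fun b => forcePairs k l ((a, b) :: acc)

/-- Whether `a` meets all sets in a list, as sets of binary digits. -/
def meetsAll (a : ℕ) (masks : List ℕ) : Bool :=
  masks.rec true fun m _ ih => (Nat.land a m).rec false fun _ _ => ih

/-- Backtracking search that intersects `s` with one member of each of the given pairs. Branches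
where `s` does not meet all of `masks` are cut off, and all others have to end in a set accepted by
`leaf`. -/
def search (leaf : ℕ → Bool) (masks : List ℕ) (l : List (ℕ × ℕ)) : ℕ → Bool :=
  l.rec leaf fun x _ ih s =>
    (force (Nat.land s x.1) fun s => (meetsAll s masks).rec true (ih s)) &&
      force (Nat.land s x.2) fun s => (meetsAll s masks).rec true (ih s)

/-- The set of the positions in a list of the numbers whose digit `k` is not set. -/
def positions (k : ℕ) : List ℕ → ℕ
  | [] => 0
  | o :: l => 2 * positions k l + (Nat.land o (2 ^ k)).rec 1 fun _ _ => 0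

/-- The sets of the positions occupied by each list in the concatenation of a list of lists, when
the first position has number `n`. -/
def blocks : ℕ → List (List ℕ) → List ℕ
  | _, [] => []
  | n, c :: cs => (2 ^ c.length - 1) <<< n :: blocks (n + c.length) cs

/-- The search for the graphs satisfying a list of clauses, deciding the edges in given order. -/
def allSatisfy (leaf : ℕ → Bool) (ks : List ℕ) (cs : List (List ℕ)) : Bool :=
  forceList (fun os => forcePairs (fun l => forceList (fun masks =>
      force (2 ^ os.length - 1) fun s => search leaf masks l s) (blocks 81 cs) [])
    (ks.map fun k => (positions (81 + k) os, positions k os)).reverse [])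
  ((List.range 81).map (2 ^ ·) ++ cs.flatten).reverse []

/-- The literal stating that `i` and `j` are adjacent. -/
def edgeLit (i j : ℕ) : ℕ := 2 ^ (9 * i + j) ||| 2 ^ (9 * j + i)

/-- The literal stating that `i` and `j` are not adjacent. -/
def nonedgeLit (i j : ℕ) : ℕ := 2 ^ (81 + (9 * i + j)) ||| 2 ^ (81 + (9 * j + i))

/-- The literals stating that `a`, `b`, `c`, `d` is a 4-cycle. -/
def cycleLits (a b c d : ℕ) : ℕ := edgeLit a b ||| edgeLit b c ||| edgeLit c d ||| edgeLit d a

/-- The literals stating that `v` is adjacent to `x`, for `x` in `l`. -/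
def edgeLits (v : ℕ) (l : List ℕ) : ℕ := l.foldr (fun x m => edgeLit v x ||| m) 0

/-- The literals stating that `v` is not adjacent to `x`, for `x` in `l`. -/
def nonedgeLits (v : ℕ) (l : List ℕ) : ℕ := l.foldr (fun x m => nonedgeLit v x ||| m) 0

/-- The clause stating that some 4-cycle avoids the closed neighbourhood of `v`. -/
def badClause (v : ℕ) : List ℕ :=
  let r (n : ℕ) : List ℕ := (List.range n).filter fun x => !Nat.beq x v
  (r 9).flatMap fun d => (r d).flatMap fun b => (r b).flatMap fun a =>
    ((r 9).filter fun c => Nat.blt a c && !(Nat.beq c b || Nat.beq c d)).map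
      fun c => cycleLits a b c d ||| nonedgeLits v [a, b, c, d]

/-- The clause stating that some vertex in `l` is adjacent to some vertex in `r`. -/
def cutClause (l r : List ℕ) : List ℕ := l.flatMap fun i => r.map fun j => edgeLit i j

/-- The clause stating that `v` has at most one neighbour in `l`. -/
def degreeClause (v : ℕ) (l : List ℕ) : List ℕ :=
  nonedgeLits v l :: l.map fun x => edgeLit v x ||| nonedgeLits v (l.filter fun y => !Nat.beq y x)

/-- The adjacencies of the vertex `i` to later ones, spaced by nine binary digits. -/
def laterRow (e i : ℕ) : ℕ :=
  (List.range (8 - i)).foldr (fun d m =>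
    bif e.testBit (10 * i + d + 1) then 2 ^ (9 * d) ||| m else m) 0

/-- Whether `next` accepts a vertex outside of `u` with the set `x` of neighbours in `u`, where the
vertices are listed in `rows` together with their neighbourhoods. -/
def anyImage (x u : ℕ) (next : ℕ → Bool) (rows : List (ℕ × ℕ)) : Bool :=
  rows.rec false fun y _ ih => (Nat.beq (Nat.land y.2 u) x).rec ih
    ((Nat.land (Nat.pow 2 y.1) u).rec (next y.1 || ih) fun _ _ => ih)

/-- The search for an isomorphism between two graphs, given by the values of `laterRow` in the first
and the list of vertices and their neighbourhoods in the second one. The images of the first `i`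
vertices are the hexadecimal digits of `p` and form the set `u`, and `w` consists of the sets of
images of the neighbours of the other vertices. It applies `k` to the full maps it finds. -/
def isoSearch (rows : List (ℕ × ℕ)) (k : ℕ → Bool) (l : List ℕ) : ℕ → ℕ → ℕ → ℕ → Bool :=
  l.rec (fun _ p _ _ => k p) fun r _ ih i p u w =>
    force (Nat.mod w 512) fun x => force (Nat.div w 512) fun w => anyImage x u (fun j =>
      force (Nat.add p (Nat.mul j (Nat.pow 16 i))) fun p => force (Nat.lor u (Nat.pow 2 j)) fun u =>
        force (Nat.add w (Nat.mul r (Nat.pow 2 j))) fun w => ih (Nat.succ i) p u w) rows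

/-- Whether the hexadecimal digits of `p` form an isomorphism from `e` to `t`. -/
def isIso (e t p : ℕ) : Bool :=
  (List.range 9).all fun j => Nat.blt (p >>> (4 * j) % 16) 9 && (List.range j).all fun i =>
    !Nat.beq (p >>> (4 * i) % 16) (p >>> (4 * j) % 16) &&
      (e.testBit (9 * i + j) == t.testBit (9 * (p >>> (4 * i) % 16) + p >>> (4 * j) % 16))

/-- The numbers of edges and the adjacency matrices of the exceptional graphs on nine vertices. -/
def exceptionalCodes : List (ℕ × ℕ) :=
  [(18, 872091274716011238836766), (17, 872091274716011238310430),
    (18, 71334593523272299252578), (18, 924125104315999978396550),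
    (16, 872091274715459335012894), (18, 128002775158120017234786)]

/-- Whether the graph with adjacency matrix `e` is found to be isomorphic to an exceptional one with
the same number of edges. The sum of the rows is taken modulo 511 to count the edges. -/
def matchesExceptional (e : ℕ) : Bool :=
  forceList (fun l => exceptionalCodes.any fun t => Nat.beq (l.foldr Nat.add 0 % 511) t.1 &&
    forcePairs (fun rows => isoSearch rows (isIso e t.2) l 0 0 0 0)
      ((List.range 9).map fun j => (j, t.2 >>> (9 * j) % 512)) [])
    ((List.range 9).map (laterRow e)).reverse []

/-- Clauses for a connected graph without isolating vertex that contains two disjoint 4-cycles and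
has maximum degree at most three. -/
def twoCyclesClauses : List (List ℕ) :=
  [cycleLits 0 1 2 3 ||| cycleLits 4 5 6 7] ::
  degreeClause 0 [2, 4, 5, 6, 7, 8] :: degreeClause 1 [3, 4, 5, 6, 7, 8] ::
  degreeClause 2 [0, 4, 5, 6, 7, 8] :: degreeClause 3 [1, 4, 5, 6, 7, 8] ::
  degreeClause 4 [6, 0, 1, 2, 3, 8] :: degreeClause 5 [7, 0, 1, 2, 3, 8] ::
  degreeClause 6 [4, 0, 1, 2, 3, 8] :: degreeClause 7 [5, 0, 1, 2, 3, 8] ::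
  cutClause [8] [0, 1, 2, 3, 4, 5, 6, 7] :: cutClause [0, 1, 2, 3] [4, 5, 6, 7, 8] ::
  cutClause [4, 5, 6, 7] [0, 1, 2, 3, 8] :: (List.range 9).map badClause

/-- Clauses for a graph without isolating vertex in which a vertex with at least four neighbours is
avoided by a 4-cycle that has an edge to one of these neighbours. -/
def starAndCycleClauses : List (List ℕ) :=
  [cycleLits 0 1 2 3 ||| nonedgeLits 8 [0, 1, 2, 3] ||| edgeLits 8 [4, 5, 6, 7] ||| edgeLit 0 4] ::
    (List.range 9).map badClause

/-- An order of the edges in which `twoCyclesClauses` are refuted quickly. -/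
def twoCyclesOrder : List ℕ :=
  [1, 11, 21, 3, 41, 51, 61, 43, 22, 24, 23, 25, 2, 26, 5, 7, 4, 6, 42, 62, 44, 8, 15, 31, 33, 13,
    14, 34, 16, 53, 35, 32, 17, 71, 12, 52]

/-- An order of the edges in which the solutions of `starAndCycleClauses` are found quickly. -/
def starAndCycleOrder : List ℕ :=
  [1, 11, 21, 3, 44, 53, 62, 71, 8, 17, 26, 35, 4, 23, 6, 25, 5, 22, 24, 7, 34, 15, 31, 14, 32, 16,
    33, 13, 41, 52, 43, 61, 42, 51, 2, 12]

theorem force_eq (n : ℕ) (k : ℕ → Bool) : force n k = k n := rfl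

theorem forceList_eq (k : List ℕ → Bool) (l acc : List ℕ) :
    forceList k l acc = k (l.reverse ++ acc) := by
  induction l generalizing acc with
  | nil => rfl
  | cons a l ih => simp [forceList, force_eq, ih]

theorem forcePairs_eq (k : List (ℕ × ℕ) → Bool) (l acc : List (ℕ × ℕ)) :
    forcePairs k l acc = k (l.reverse ++ acc) := by
  induction l generalizing acc with
  | nil => rfl
  | cons a l ih => simp [forcePairs, force_eq, ih]

theorem meetsAll_cons (a m : ℕ) (l : List ℕ) :
    meetsAll a (m :: l) = (Nat.land a m != 0 && meetsAll a l) := by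
  change Nat.rec (motive := fun _ => Bool) false (fun _ _ => meetsAll a l) (Nat.land a m) = _
  cases Nat.land a m <;> simp

theorem meetsAll_eq_true {T : ℕ → Prop} {a : ℕ} {masks : List ℕ}
    (hmasks : ∀ m ∈ masks, ∃ i, m.testBit i ∧ T i) (ha : ∀ i, T i → a.testBit i) :
    meetsAll a masks = true := by
  induction masks with
  | nil => rfl
  | cons m l ih =>
    rw [meetsAll_cons, Bool.and_eq_true]
    refine ⟨?_, ih fun x hx => hmasks x (List.mem_cons_of_mem _ hx)⟩
    obtain ⟨i, hi, hT⟩ := hmasks m List.mem_cons_self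
    have h : (a &&& m).testBit i = true := by rw [Nat.testBit_and, ha i hT, hi]; rfl
    rw [bne_iff_ne]
    intro h0
    rw [show a &&& m = 0 from h0, Nat.zero_testBit] at h
    exact Bool.false_ne_true h

theorem search_cons (leaf : ℕ → Bool) (masks : List ℕ) (x : ℕ × ℕ) (l : List (ℕ × ℕ)) (s : ℕ) :
    search leaf masks (x :: l) s =
      ((meetsAll (s &&& x.1) masks).rec true (search leaf masks l (s &&& x.1)) &&
        (meetsAll (s &&& x.2) masks).rec true (search leaf masks l (s &&& x.2))) := rfl

/-- If `search` succeeds, then it finds an accepted set containing `T`, provided that `T` meets all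
masks and is contained in the set chosen in each step according to `B`. -/
theorem exists_leaf_of_search {leaf : ℕ → Bool} {masks ks : List ℕ} {f : ℕ → ℕ × ℕ}
    {T B : ℕ → Prop} (hmasks : ∀ m ∈ masks, ∃ i, m.testBit i ∧ T i)
    (hpos : ∀ k ∈ ks, B k → ∀ i, T i → (f k).1.testBit i)
    (hneg : ∀ k ∈ ks, ¬ B k → ∀ i, T i → (f k).2.testBit i) {s : ℕ}
    (hs : ∀ i, T i → s.testBit i) (h : search leaf masks (ks.map f) s = true) :
    ∃ e : ℕ, leaf e = true ∧ (∀ i, T i → e.testBit i) ∧ (∀ i, e.testBit i → s.testBit i) ∧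
      ∀ k ∈ ks, ¬ B k → ∀ i, e.testBit i → (f k).2.testBit i := by
  induction ks generalizing s with
  | nil => exact ⟨s, h, hs, fun _ hi => hi, by simp⟩
  | cons k ks ih =>
    rw [List.map_cons, search_cons, Bool.and_eq_true] at h
    simp only [List.forall_mem_cons] at hpos hneg
    by_cases hB : B k
    · have hs' : ∀ i, T i → (s &&& (f k).1).testBit i := fun i hi => by
        rw [Nat.testBit_and, hs i hi, hpos.1 hB i hi]; rfl
      have h1 := h.1
      rw [meetsAll_eq_true hmasks hs'] at h1
      obtain ⟨e, he, hTe, hes, hk⟩ := ih hpos.2 hneg.2 hs' h1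
      refine ⟨e, he, hTe, fun i hi => ?_, List.forall_mem_cons.2 ⟨fun hn => absurd hB hn, hk⟩⟩
      have := hes i hi
      rw [Nat.testBit_and, Bool.and_eq_true] at this
      exact this.1
    · have hs' : ∀ i, T i → (s &&& (f k).2).testBit i := fun i hi => by
        rw [Nat.testBit_and, hs i hi, hneg.1 hB i hi]; rfl
      have h2 := h.2
      rw [meetsAll_eq_true hmasks hs'] at h2
      obtain ⟨e, he, hTe, hes, hk⟩ := ih hpos.2 hneg.2 hs' h2
      have hes' : ∀ i, e.testBit i → s.testBit i ∧ (f k).2.testBit i := fun i hi => by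
        have := hes i hi
        rwa [Nat.testBit_and, Bool.and_eq_true] at this
      exact ⟨e, he, hTe, fun i hi => (hes' i hi).1,
        List.forall_mem_cons.2 ⟨fun _ i hi => (hes' i hi).2, hk⟩⟩

theorem testBit_positions (k : ℕ) (l : List ℕ) (i : ℕ) :
    (positions k l).testBit i = true ↔ ∃ o, l[i]? = some o ∧ o.testBit k = false := by
  induction l generalizing i with
  | nil => simp [positions]
  | cons o l ih =>
    have h : positions k (o :: l) = Nat.bit (!o.testBit k) (positions k l) := by
      have ho : Nat.land o (2 ^ k) = (o.testBit k).toNat * 2 ^ k := Nat.and_two_pow o k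
      change 2 * positions k l + (Nat.land o (2 ^ k)).rec 1 (fun _ _ => 0) = _
      rw [ho]
      cases o.testBit k
      · simp [Nat.bit]
      · obtain ⟨m, hm⟩ := Nat.exists_eq_succ_of_ne_zero (pow_ne_zero k two_ne_zero)
        simp [Nat.bit, hm]
    rw [h]
    cases i with
    | zero => simp
    | succ i => simp [Nat.testBit_bit_succ, ih]

theorem exists_testBit_of_mem_blocks {Q : ℕ → Prop} {cs : List (List ℕ)}
    (hcs : ∀ c ∈ cs, ∃ o ∈ c, Q o) (l : List ℕ) :
    ∀ m ∈ blocks l.length cs, ∃ i, m.testBit i ∧ ∃ o, (l ++ cs.flatten)[i]? = some o ∧ Q o := by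
  induction cs generalizing l with
  | nil => simp [blocks]
  | cons c cs ih =>
    rw [List.forall_mem_cons] at hcs
    rw [blocks, List.forall_mem_cons]
    constructor
    · obtain ⟨o, ho, hQ⟩ := hcs.1
      obtain ⟨j, hj, rfl⟩ := List.mem_iff_getElem.1 ho
      refine ⟨l.length + j, ?_, _, ?_, hQ⟩
      · simp [Nat.testBit_shiftLeft, Nat.testBit_two_pow_sub_one, hj]
      · rw [List.getElem?_append_right (by omega), Nat.add_sub_cancel_left,
          List.flatten_cons, List.getElem?_append_left hj, List.getElem?_eq_getElem hj]
    · have := ih hcs.2 (l ++ c)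
      simpa using this

/-- The literal with index `k` holds in the graph with adjacency relation `A`. -/
def Holds (A : ℕ → ℕ → Prop) (k : ℕ) : Prop :=
  if k < 81 then A (k / 9) (k % 9) else ¬ A ((k - 81) / 9) ((k - 81) % 9)

/-- All literals in `o` hold in the graph with adjacency relation `A`. -/
def Models (A : ℕ → ℕ → Prop) (o : ℕ) : Prop := ∀ k, o.testBit k → Holds A k

theorem exists_leaf_of_allSatisfy {A : ℕ → ℕ → Prop} {leaf : ℕ → Bool} {ks : List ℕ}
    {cs : List (List ℕ)} (hks : ∀ k ∈ ks, k < 81) (hcs : ∀ c ∈ cs, ∃ o ∈ c, Models A o)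
    (h : allSatisfy leaf ks cs = true) :
    ∃ e : ℕ, leaf e = true ∧ ∀ k ∈ ks, (e.testBit k ↔ A (k / 9) (k % 9)) := by
  set os : List ℕ := (List.range 81).map (2 ^ ·) ++ cs.flatten with hos
  have hget : ∀ k < 81, os[k]? = some (2 ^ k) := fun k hk => by
    rw [hos, List.getElem?_append_left (by simpa using hk)]
    simp [hk]
  have hlen : ((List.range 81).map (2 ^ ·)).length = 81 := by simp
  have hmasks := exists_testBit_of_mem_blocks hcs ((List.range 81).map (2 ^ ·))
  rw [hlen, ← hos] at hmasks
  simp only [allSatisfy, ← hos, forceList_eq, forcePairs_eq, force_eq, List.reverse_reverse,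
    List.append_nil] at h
  have hpos : ∀ k ∈ ks, A (k / 9) (k % 9) → ∀ i, (∃ o, os[i]? = some o ∧ Models A o) →
      (positions (81 + k) os).testBit i := by
    rintro k - hA i ⟨o, ho, hM⟩
    refine (testBit_positions _ _ _).2 ⟨o, ho, Bool.eq_false_iff.2 fun hk => ?_⟩
    have := hM _ hk
    rw [Holds, if_neg (by omega), Nat.add_sub_cancel_left] at this
    exact this hA
  have hneg : ∀ k ∈ ks, ¬ A (k / 9) (k % 9) → ∀ i, (∃ o, os[i]? = some o ∧ Models A o) →
      (positions k os).testBit i := by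
    rintro k hkk hA i ⟨o, ho, hM⟩
    refine (testBit_positions _ _ _).2 ⟨o, ho, Bool.eq_false_iff.2 fun hk => hA ?_⟩
    have := hM _ hk
    rwa [Holds, if_pos (hks k hkk)] at this
  have hs : ∀ i, (∃ o, os[i]? = some o ∧ Models A o) → (2 ^ os.length - 1).testBit i := by
    rintro i ⟨o, ho, -⟩
    obtain ⟨hi, -⟩ := List.getElem?_eq_some_iff.1 ho
    simpa [Nat.testBit_two_pow_sub_one] using hi
  obtain ⟨e, he, hTe, -, hk⟩ := exists_leaf_of_search
    (fun m hm => hmasks m (List.mem_reverse.1 hm)) hpos hneg hs h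
  refine ⟨e, he, fun k hkk => ⟨fun hek => ?_, fun hA => hTe k ⟨_, hget k (hks k hkk), ?_⟩⟩⟩
  · by_contra hA
    obtain ⟨o, ho, hok⟩ := (testBit_positions _ _ _).1 (hk k hkk hA k hek)
    rw [hget k (hks k hkk), Option.some_inj] at ho
    simp [← ho] at hok
  · intro j hj
    rw [Nat.testBit_two_pow, decide_eq_true_iff] at hj
    simpa [Holds, ← hj, hks k hkk] using hA

theorem exists_of_anyImage {x u : ℕ} {next : ℕ → Bool} {rows : List (ℕ × ℕ)}
    (h : anyImage x u next rows = true) : ∃ j, next j = true := by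
  induction rows with
  | nil => exact absurd h Bool.false_ne_true
  | cons y rows ih =>
    change Bool.rec (motive := fun _ => Bool) (anyImage x u next rows)
      (Nat.rec (motive := fun _ => Bool) (next y.1 || anyImage x u next rows)
        (fun _ _ => anyImage x u next rows) (Nat.land (Nat.pow 2 y.1) u))
      (Nat.beq (Nat.land y.2 u) x) = true at h
    cases hx : Nat.beq (Nat.land y.2 u) x with
    | false => exact ih (by simpa only [hx] using h)
    | true =>
      cases hu : Nat.land (Nat.pow 2 y.1) u with
      | zero =>
        simp only [hx, hu] at h
        change (next y.1 || anyImage x u next rows) = true at h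
        exact ((Bool.or_eq_true _ _).mp h).elim (fun h => ⟨_, h⟩) ih
      | succ n => exact ih (by simpa only [hx, hu] using h)

theorem exists_of_isoSearch {rows : List (ℕ × ℕ)} {k : ℕ → Bool} {l : List ℕ} {i p u w : ℕ}
    (h : isoSearch rows k l i p u w = true) : ∃ p, k p = true := by
  induction l generalizing i p u w with
  | nil => exact ⟨p, h⟩
  | cons r l ih =>
    change anyImage (w % 512) u (fun j => isoSearch rows k l (i + 1) (p + j * 16 ^ i) (u ||| 2 ^ j)
      (w / 512 + r * 2 ^ j)) rows = true at h
    obtain ⟨j, hj⟩ := exists_of_anyImage h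
    exact ih hj

theorem exists_isIso_of_matchesExceptional {e : ℕ} (h : matchesExceptional e = true) :
    ∃ t ∈ exceptionalCodes, ∃ p, isIso e t.2 p = true := by
  simp only [matchesExceptional, forceList_eq, forcePairs_eq, List.any_eq_true,
    Bool.and_eq_true] at h
  obtain ⟨t, ht, -, h⟩ := h
  exact ⟨t, ht, exists_of_isoSearch h⟩

theorem models_or {A : ℕ → ℕ → Prop} {o o' : ℕ} :
    Models A (o ||| o') ↔ Models A o ∧ Models A o' := by
  simp only [Models, Nat.testBit_or, Bool.or_eq_true, or_imp, forall_and]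

theorem models_zero {A : ℕ → ℕ → Prop} : Models A 0 := by simp [Models]

theorem models_two_pow {A : ℕ → ℕ → Prop} {k : ℕ} : Models A (2 ^ k) ↔ Holds A k := by
  simp [Models, Nat.testBit_two_pow]

/-- The adjacency relation of a graph on `Fin 9`, as a relation between natural numbers. -/
def NatAdj (H : SimpleGraph (Fin 9)) (i j : ℕ) : Prop :=
  ∃ (hi : i < 9) (hj : j < 9), H.Adj ⟨i, hi⟩ ⟨j, hj⟩

theorem natAdj_comm {H : SimpleGraph (Fin 9)} {i j : ℕ} : NatAdj H i j ↔ NatAdj H j i :=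
  ⟨fun ⟨hi, hj, h⟩ => ⟨hj, hi, h.symm⟩, fun ⟨hi, hj, h⟩ => ⟨hj, hi, h.symm⟩⟩

theorem natAdj_val {H : SimpleGraph (Fin 9)} {a b : Fin 9} : NatAdj H a b ↔ H.Adj a b :=
  ⟨fun ⟨_, _, h⟩ => h, fun h => ⟨a.2, b.2, h⟩⟩

section Clauses

variable {H : SimpleGraph (Fin 9)} {i j : ℕ}

theorem models_edgeLit (hi : i < 9) (hj : j < 9) :
    Models (NatAdj H) (edgeLit i j) ↔ NatAdj H i j := by
  rw [edgeLit, models_or, models_two_pow, models_two_pow, Holds, Holds, if_pos (by omega),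
    if_pos (by omega), show (9 * i + j) / 9 = i by omega, show (9 * i + j) % 9 = j by omega,
    show (9 * j + i) / 9 = j by omega, show (9 * j + i) % 9 = i by omega, natAdj_comm (i := j),
    and_self_iff]

theorem models_nonedgeLit (hi : i < 9) (hj : j < 9) :
    Models (NatAdj H) (nonedgeLit i j) ↔ ¬ NatAdj H i j := by
  rw [nonedgeLit, models_or, models_two_pow, models_two_pow, Holds, Holds, if_neg (by omega),
    if_neg (by omega), Nat.add_sub_cancel_left, Nat.add_sub_cancel_left,
    show (9 * i + j) / 9 = i by omega, show (9 * i + j) % 9 = j by omega,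
    show (9 * j + i) / 9 = j by omega, show (9 * j + i) % 9 = i by omega, natAdj_comm (i := j),
    and_self_iff]

theorem models_edgeLits (hi : i < 9) {l : List ℕ} (hl : ∀ x ∈ l, x < 9) :
    Models (NatAdj H) (edgeLits i l) ↔ ∀ x ∈ l, NatAdj H i x := by
  induction l with
  | nil => simp [edgeLits, models_zero]
  | cons x l ih =>
    rw [List.forall_mem_cons] at hl ⊢
    rw [← ih hl.2, ← models_edgeLit hi hl.1, ← models_or]
    rfl

theorem models_nonedgeLits (hi : i < 9) {l : List ℕ} (hl : ∀ x ∈ l, x < 9) :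
    Models (NatAdj H) (nonedgeLits i l) ↔ ∀ x ∈ l, ¬ NatAdj H i x := by
  induction l with
  | nil => simp [nonedgeLits, models_zero]
  | cons x l ih =>
    rw [List.forall_mem_cons] at hl ⊢
    rw [← ih hl.2, ← models_nonedgeLit hi hl.1, ← models_or]
    rfl

end Clauses

/-- `a`, `b`, `c`, `d` are the consecutive vertices of a 4-cycle in `G`. -/
def IsFourCycle {V : Type*} (G : SimpleGraph V) (a b c d : V) : Prop :=
  G.Adj a b ∧ G.Adj b c ∧ G.Adj c d ∧ G.Adj d a ∧ a ≠ c ∧ b ≠ d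

/-- `x` does not lie in the closed neighbourhood of `v`. -/
def Avoids {V : Type*} (G : SimpleGraph V) (v x : V) : Prop := v ≠ x ∧ ¬ G.Adj v x

/-- The closed neighbourhood of each vertex of `G` is avoided by a 4-cycle. -/
def NoIsolatingVertex {V : Type*} (G : SimpleGraph V) : Prop :=
  ∀ v, ∃ a b c d, IsFourCycle G a b c d ∧ Avoids G v a ∧ Avoids G v b ∧ Avoids G v c ∧ Avoids G v d

section Graphs

variable {V W : Type*} {G : SimpleGraph V} {G' : SimpleGraph W}

theorem IsFourCycle.rotate {a b c d : V} (h : IsFourCycle G a b c d) : IsFourCycle G b c d a :=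
  ⟨h.2.1, h.2.2.1, h.2.2.2.1, h.1, h.2.2.2.2.2, h.2.2.2.2.1.symm⟩

theorem IsFourCycle.nodup {a b c d : V} (h : IsFourCycle G a b c d) : [a, b, c, d].Nodup := by
  simp [h.1.ne, h.2.1.ne, h.2.2.1.ne, h.2.2.2.1.ne.symm, h.2.2.2.2.1, h.2.2.2.2.2]

theorem IsFourCycle.reverse {a b c d : V} (h : IsFourCycle G a b c d) : IsFourCycle G a d c b :=
  ⟨h.2.2.2.1.symm, h.2.2.1.symm, h.2.1.symm, h.1.symm, h.2.2.2.2.1, h.2.2.2.2.2.symm⟩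

theorem IsFourCycle.map {a b c d : V} (h : IsFourCycle G a b c d) (f : G ↪g G') :
    IsFourCycle G' (f a) (f b) (f c) (f d) :=
  ⟨f.map_adj_iff.2 h.1, f.map_adj_iff.2 h.2.1, f.map_adj_iff.2 h.2.2.1, f.map_adj_iff.2 h.2.2.2.1,
    f.injective.ne h.2.2.2.2.1, f.injective.ne h.2.2.2.2.2⟩

theorem IsFourCycle.of_map {a b c d : V} (f : G ≃g G')
    (h : IsFourCycle G' (f a) (f b) (f c) (f d)) : IsFourCycle G a b c d := by
  simpa [IsFourCycle, f.map_adj_iff] using h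

theorem Avoids.map {v x : V} (h : Avoids G v x) (f : G ↪g G') : Avoids G' (f v) (f x) :=
  ⟨f.injective.ne h.1, fun hn => h.2 (f.map_adj_iff.1 hn)⟩

theorem NoIsolatingVertex.iso (h : NoIsolatingVertex G) (f : G ≃g G') : NoIsolatingVertex G' := by
  intro w
  obtain ⟨a, b, c, d, hc, ha, hb, hc', hd⟩ := h (f.symm w)
  have hw : f.toEmbedding (f.symm w) = w := f.apply_symm_apply w
  refine ⟨_, _, _, _, hc.map f.toEmbedding, ?_, ?_, ?_, ?_⟩ <;> rw [← hw]
  exacts [ha.map _, hb.map _, hc'.map _, hd.map _]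

theorem exists_adj_of_connected (h : G.Connected) {S : Set V} {x y : V} (hx : x ∈ S) (hy : y ∉ S) :
    ∃ u ∈ S, ∃ w ∉ S, G.Adj u w := by
  obtain ⟨p⟩ := h.preconnected x y
  obtain ⟨d, -, h1, h2⟩ := p.exists_boundary_dart S hx hy
  exact ⟨d.fst, h1, d.snd, h2, d.adj⟩

/-- The labels of a 4-cycle can be normalized by rotation and reflection. -/
theorem exists_sorted [LinearOrder V] {P : V → Prop} {a b c d : V} (h : IsFourCycle G a b c d)
    (ha : P a) (hb : P b) (hc : P c) (hd : P d) :
    ∃ a b c d, IsFourCycle G a b c d ∧ (P a ∧ P b ∧ P c ∧ P d) ∧ a < b ∧ b < d ∧ a < c := by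
  have key : ∀ a b c d, IsFourCycle G a b c d → P a → P b → P c → P d → a ≤ b → a ≤ c → a ≤ d →
      ∃ a b c d, IsFourCycle G a b c d ∧ (P a ∧ P b ∧ P c ∧ P d) ∧ a < b ∧ b < d ∧ a < c := by
    intro a b c d h ha hb hc hd hab hac had
    have hab := hab.lt_of_ne h.1.ne
    have had := had.lt_of_ne h.2.2.2.1.ne.symm
    have hac := hac.lt_of_ne h.2.2.2.2.1
    rcases h.2.2.2.2.2.lt_or_gt with hbd | hbd
    · exact ⟨a, b, c, d, h, ⟨ha, hb, hc, hd⟩, hab, hbd, hac⟩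
    · exact ⟨a, d, c, b, h.reverse, ⟨ha, hd, hc, hb⟩, had, hbd, hac⟩
  rcases le_total a b with h1 | h1 <;> rcases le_total c d with h2 | h2
  · rcases le_total a c with h3 | h3
    · exact key a b c d h ha hb hc hd h1 h3 (h3.trans h2)
    · exact key c d a b h.rotate.rotate hc hd ha hb h2 h3 (h3.trans h1)
  · rcases le_total a d with h3 | h3
    · exact key a b c d h ha hb hc hd h1 (h3.trans h2) h3
    · exact key d a b c h.rotate.rotate.rotate hd ha hb hc h3 (h3.trans h1) h2
  · rcases le_total b c with h3 | h3
    · exact key b c d a h.rotate hb hc hd ha h3 (h3.trans h2) h1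
    · exact key c d a b h.rotate.rotate hc hd ha hb h2 (h3.trans h1) h3
  · rcases le_total b d with h3 | h3
    · exact key b c d a h.rotate hb hc hd ha (h3.trans h2) h3 h1
    · exact key d a b c h.rotate.rotate.rotate hd ha hb hc (h3.trans h1) h3 h2

end Graphs

section NineVertices

variable {H : SimpleGraph (Fin 9)}

theorem models_cycleLits {a b c d : ℕ} (h1 : NatAdj H a b) (h2 : NatAdj H b c)
    (h3 : NatAdj H c d) (h4 : NatAdj H d a) : Models (NatAdj H) (cycleLits a b c d) := by
  have edge : ∀ {i j : ℕ}, NatAdj H i j → Models (NatAdj H) (edgeLit i j) := fun h =>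
    (models_edgeLit h.1 h.2.1).2 h
  exact models_or.2 ⟨models_or.2 ⟨models_or.2 ⟨edge h1, edge h2⟩, edge h3⟩, edge h4⟩

theorem exists_mem_badClause (h : NoIsolatingVertex H) {v : ℕ} (hv : v < 9) :
    ∃ o ∈ badClause v, Models (NatAdj H) o := by
  lift v to Fin 9 using hv
  obtain ⟨_, _, _, _, h, ha, hb, hc, hd⟩ := h v
  obtain ⟨a, b, c, d, h, ⟨ha, hb, hc, hd⟩, hab, hbd, hac⟩ := exists_sorted h ha hb hc hd
  refine ⟨cycleLits a b c d ||| nonedgeLits v [a, b, c, d], ?_, models_or.2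
    ⟨models_cycleLits (natAdj_val.2 h.1) (natAdj_val.2 h.2.1) (natAdj_val.2 h.2.2.1)
      (natAdj_val.2 h.2.2.2.1), (models_nonedgeLits v.2 (by simp)).2 (by
      simpa [natAdj_val] using ⟨ha.2, hb.2, hc.2, hd.2⟩)⟩⟩
  have hne : ∀ {x y : Fin 9}, x ≠ y → ¬ (x : ℕ) = y := fun h h' => h (Fin.ext h')
  simp only [badClause, List.mem_flatMap, List.mem_map, List.mem_filter, List.mem_range,
    Bool.and_eq_true, Bool.not_eq_true', Bool.or_eq_false_iff, Nat.blt_eq]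
  have beq_false : ∀ {x y : Fin 9}, x ≠ y → Nat.beq x y = false := fun h =>
    Bool.eq_false_iff.2 fun h' => hne h (Nat.eq_of_beq_eq_true h')
  exact ⟨d, ⟨d.2, beq_false hd.1.symm⟩, b, ⟨hbd, beq_false hb.1.symm⟩, a,
    ⟨hab, beq_false ha.1.symm⟩, c,
    ⟨⟨c.2, beq_false hc.1.symm⟩, hac, beq_false h.2.1.ne.symm, beq_false h.2.2.1.ne⟩, rfl⟩

theorem exists_mem_cutClause (h : H.Connected) {l r : List ℕ} (hl : ∃ x ∈ l, x < 9)
    (hr : ∃ x < 9, x ∉ l) (hlr : ∀ x < 9, x ∉ l → x ∈ r) :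
    ∃ o ∈ cutClause l r, Models (NatAdj H) o := by
  obtain ⟨x, hx, hx9⟩ := hl
  obtain ⟨y, hy9, hy⟩ := hr
  obtain ⟨u, hu, w, hw, huw⟩ := exists_adj_of_connected h (S := {x : Fin 9 | (x : ℕ) ∈ l})
    (x := ⟨x, hx9⟩) (y := ⟨y, hy9⟩) hx hy
  exact ⟨edgeLit u w, List.mem_flatMap.2 ⟨u, hu, List.mem_map.2 ⟨w, hlr w w.2 hw, rfl⟩⟩,
    (models_edgeLit u.2 w.2).2 (natAdj_val.2 huw)⟩

theorem exists_mem_degreeClause {v : ℕ} {l : List ℕ} (hv : v < 9) (hl : ∀ x ∈ l, x < 9)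
    (h : ∀ x ∈ l, ∀ y ∈ l, NatAdj H v x → NatAdj H v y → x = y) :
    ∃ o ∈ degreeClause v l, Models (NatAdj H) o := by
  by_cases hx : ∃ x ∈ l, NatAdj H v x
  · obtain ⟨x, hx, hvx⟩ := hx
    refine ⟨_, List.mem_cons_of_mem _ (List.mem_map.2 ⟨x, hx, rfl⟩), models_or.2
      ⟨(models_edgeLit hv (hl x hx)).2 hvx, (models_nonedgeLits hv ?_).2 ?_⟩⟩
    · exact fun y hy => hl y (List.mem_of_mem_filter hy)
    · intro y hy hvy
      obtain ⟨hy, hyx⟩ := List.mem_filter.1 hy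
      rw [h y hy x hx hvy hvx] at hyx
      simp at hyx
  · push Not at hx
    exact ⟨_, List.mem_cons_self, (models_nonedgeLits hv hl).2 hx⟩

theorem exists_iso_of_isIso {X : SimpleGraph (Fin 9)} {e t p : ℕ}
    (he : ∀ i j : Fin 9, i < j → (e.testBit (9 * i + j) ↔ H.Adj i j))
    (ht : ∀ i j : Fin 9, X.Adj i j ↔ t.testBit (9 * i + j)) (h : isIso e t p = true) :
    Nonempty (H ≃g X) := by
  simp only [isIso, List.all_eq_true, List.mem_range, Bool.and_eq_true, Nat.blt_eq,
    Bool.not_eq_true', beq_iff_eq] at h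
  let f (i : Fin 9) : Fin 9 := ⟨(p >>> (4 * i.val)) % 16, (h i i.2).1⟩
  have hlt : ∀ i j : Fin 9, i < j → f i ≠ f j ∧ (X.Adj (f i) (f j) ↔ H.Adj i j) := by
    intro i j hij
    obtain ⟨h1, h2⟩ := (h j j.2).2 i hij
    refine ⟨fun hf => ?_, ?_⟩
    · rw [show (p >>> (4 * i.val)) % 16 = (p >>> (4 * j.val)) % 16 from congrArg Fin.val hf] at h1
      simp at h1
    · rw [ht, ← he i j hij, h2]
  have hf : Function.Injective f := by
    intro i j hij
    rcases lt_trichotomy i j with h | h | h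
    · exact absurd hij (hlt i j h).1
    · exact h
    · exact absurd hij.symm (hlt j i h).1
  refine ⟨⟨Equiv.ofBijective f (Finite.injective_iff_bijective.1 hf), ?_⟩⟩
  intro i j
  change X.Adj (f i) (f j) ↔ H.Adj i j
  rcases lt_trichotomy i j with h | rfl | h
  · exact (hlt i j h).2
  · simp
  · rw [X.adj_comm, H.adj_comm]
    exact (hlt j i h).2

theorem exists_mem_calG9 : ∀ t ∈ exceptionalCodes, ∃ X : SimpleGraph (Fin 9),
    ⟨9, X⟩ ∈ calG9 ∧ ∀ i j : Fin 9, X.Adj i j ↔ t.2.testBit (9 * i + j) := by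
  simp only [exceptionalCodes, List.forall_mem_cons, List.not_mem_nil, false_imp_iff, implies_true,
    and_true]
  refine ⟨⟨Gr4, by simp [calG9], ?_⟩, ⟨Gr5, by simp [calG9], ?_⟩, ⟨Gr3, by simp [calG9], ?_⟩,
    ⟨Gr1, by simp [calG9], ?_⟩, ⟨Gr6, by simp [calG9], ?_⟩, ⟨Gr2, by simp [calG9], ?_⟩⟩ <;>
  · simp only [Gr1, Gr2, Gr3, Gr4, Gr5, Gr6, fromEdgeSet_adj, Set.mem_insert_iff,
      Set.mem_singleton_iff]
    decide +kernel

theorem exists_two_neighbors_of_mem : ∀ t ∈ exceptionalCodes, ∀ i : Fin 9, ∃ j k : Fin 9, j ≠ k ∧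
    t.2.testBit (9 * i + j) ∧ t.2.testBit (9 * i + k) := by
  decide +kernel

set_option maxRecDepth 100000 in
theorem allSatisfy_twoCycles :
    allSatisfy (fun _ => false) twoCyclesOrder twoCyclesClauses = true := by decide +kernel

set_option maxRecDepth 100000 in
theorem allSatisfy_starAndCycle :
    allSatisfy matchesExceptional starAndCycleOrder starAndCycleClauses = true := by decide +kernel

/-- `G` is one of the exceptional graphs on nine vertices, and has minimum degree at least two. -/
def IsExceptional {V : Type*} (G : SimpleGraph V) : Prop :=
  ∃ X : SimpleGraph (Fin 9), ⟨9, X⟩ ∈ calG9 ∧ (∀ v, ∃ x y, x ≠ y ∧ X.Adj v x ∧ X.Adj v y) ∧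
    Nonempty (G ≃g X)

theorem IsExceptional.of_iso {V W : Type*} {G : SimpleGraph V} {G' : SimpleGraph W}
    (h : IsExceptional G') (f : G ≃g G') : IsExceptional G := by
  obtain ⟨X, hX, hd, ⟨g⟩⟩ := h
  exact ⟨X, hX, hd, ⟨f.trans g⟩⟩

theorem isExceptional_of_star (h : NoIsolatingVertex H) (hc : IsFourCycle H 0 1 2 3)
    (hn : ∀ x ∈ [0, 1, 2, 3], ¬ H.Adj 8 x) (ha : ∀ x ∈ [4, 5, 6, 7], H.Adj 8 x) (h04 : H.Adj 0 4) :
    IsExceptional H := by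
  have hcs : ∀ c ∈ starAndCycleClauses, ∃ o ∈ c, Models (NatAdj H) o := by
    rw [starAndCycleClauses, List.forall_mem_cons]
    constructor
    · simp only [List.forall_mem_cons] at hn ha
      refine ⟨_, List.mem_singleton.2 rfl, models_or.2 ⟨models_or.2 ⟨models_or.2 ⟨?_,
        (models_nonedgeLits (by decide) (by decide)).2 ?_⟩,
        (models_edgeLits (by decide) (by decide)).2 ?_⟩,
        (models_edgeLit (by decide) (by decide)).2 (natAdj_val.2 h04)⟩⟩
      · exact models_cycleLits (natAdj_val.2 hc.1) (natAdj_val.2 hc.2.1) (natAdj_val.2 hc.2.2.1)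
          (natAdj_val.2 hc.2.2.2.1)
      · simp only [List.forall_mem_cons]
        exact ⟨fun h => hn.1 (natAdj_val.1 h), fun h => hn.2.1 (natAdj_val.1 h),
          fun h => hn.2.2.1 (natAdj_val.1 h), fun h => hn.2.2.2.1 (natAdj_val.1 h), by simp⟩
      · simp only [List.forall_mem_cons]
        exact ⟨natAdj_val.2 ha.1, natAdj_val.2 ha.2.1, natAdj_val.2 ha.2.2.1,
          natAdj_val.2 ha.2.2.2.1, by simp⟩
    · intro c hc
      obtain ⟨v, hv, rfl⟩ := List.mem_map.1 hc
      exact exists_mem_badClause h (List.mem_range.1 hv)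
  obtain ⟨e, he, hadj⟩ := exists_leaf_of_allSatisfy (by decide) hcs allSatisfy_starAndCycle
  obtain ⟨t, ht, p, hp⟩ := exists_isIso_of_matchesExceptional he
  obtain ⟨X, hX, hXt⟩ := exists_mem_calG9 t ht
  refine ⟨X, hX, fun v => ?_, exists_iso_of_isIso (fun i j hij => ?_) hXt hp⟩
  · obtain ⟨x, y, hxy, hx, hy⟩ := exists_two_neighbors_of_mem t ht v
    exact ⟨x, y, hxy, (hXt v x).2 hx, (hXt v y).2 hy⟩
  · have hmem : ∀ i j : Fin 9, i < j → 9 * i.val + j.val ∈ starAndCycleOrder := by decide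
    rw [hadj _ (hmem i j hij), show (9 * i.val + j.val) / 9 = i by omega,
      show (9 * i.val + j.val) % 9 = j by omega, natAdj_val]

theorem not_two_cycles (h : NoIsolatingVertex H) (hH : H.Connected) (hc : IsFourCycle H 0 1 2 3)
    (hc' : IsFourCycle H 4 5 6 7)
    (hd : ∀ v, ∀ l : List (Fin 9), l.Nodup → (∀ x ∈ l, H.Adj v x) → l.length ≠ 4) : False := by
  have key : ∀ (v p q : ℕ) (l : List ℕ), NatAdj H v p → NatAdj H v q →
      (p ≠ q ∧ (∀ x ∈ l, x < 9) ∧ p ∉ l ∧ q ∉ l) →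
      ∃ o ∈ degreeClause v l, Models (NatAdj H) o := by
    rintro v p q l ⟨hv, hp9, hp⟩ ⟨_, hq9, hq⟩ ⟨hpq, hl, hpl, hql⟩
    refine exists_mem_degreeClause hv hl fun x hx y hy ⟨_, hx9, hvx⟩ ⟨_, hy9, hvy⟩ => ?_
    by_contra hxy
    refine hd ⟨v, hv⟩ [⟨p, hp9⟩, ⟨q, hq9⟩, ⟨x, hx9⟩, ⟨y, hy9⟩] ?_ (by simp [hp, hq, hvx, hvy]) rfl
    have := ne_of_mem_of_not_mem hx hpl
    have := ne_of_mem_of_not_mem hy hpl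
    have := ne_of_mem_of_not_mem hx hql
    have := ne_of_mem_of_not_mem hy hql
    simp
    grind
  have cut : ∀ l r : List ℕ, ((∃ x ∈ l, x < 9) ∧ (∃ x < 9, x ∉ l) ∧ ∀ x < 9, x ∉ l → x ∈ r) →
      ∃ o ∈ cutClause l r, Models (NatAdj H) o := fun l r h =>
    exists_mem_cutClause hH h.1 h.2.1 h.2.2
  have hcs : ∀ c ∈ twoCyclesClauses, ∃ o ∈ c, Models (NatAdj H) o := by
    simp only [twoCyclesClauses, List.forall_mem_cons]
    have h01 : NatAdj H 0 1 := natAdj_val.2 hc.1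
    have h12 : NatAdj H 1 2 := natAdj_val.2 hc.2.1
    have h23 : NatAdj H 2 3 := natAdj_val.2 hc.2.2.1
    have h30 : NatAdj H 3 0 := natAdj_val.2 hc.2.2.2.1
    have h45 : NatAdj H 4 5 := natAdj_val.2 hc'.1
    have h56 : NatAdj H 5 6 := natAdj_val.2 hc'.2.1
    have h67 : NatAdj H 6 7 := natAdj_val.2 hc'.2.2.1
    have h74 : NatAdj H 7 4 := natAdj_val.2 hc'.2.2.2.1
    refine ⟨⟨_, List.mem_singleton.2 rfl, models_or.2 ⟨models_cycleLits h01 h12 h23 h30,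
        models_cycleLits h45 h56 h67 h74⟩⟩,
      key 0 1 3 _ h01 (natAdj_comm.1 h30) (by decide),
      key 1 2 0 _ h12 (natAdj_comm.1 h01) (by decide),
      key 2 3 1 _ h23 (natAdj_comm.1 h12) (by decide),
      key 3 0 2 _ h30 (natAdj_comm.1 h23) (by decide),
      key 4 5 7 _ h45 (natAdj_comm.1 h74) (by decide),
      key 5 6 4 _ h56 (natAdj_comm.1 h45) (by decide),
      key 6 7 5 _ h67 (natAdj_comm.1 h56) (by decide),
      key 7 4 6 _ h74 (natAdj_comm.1 h67) (by decide),
      cut _ _ (by decide), cut _ _ (by decide), cut _ _ (by decide), fun c hc => ?_⟩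
    obtain ⟨v, hv, rfl⟩ := List.mem_map.1 hc
    exact exists_mem_badClause h (List.mem_range.1 hv)
  obtain ⟨e, he, -⟩ := exists_leaf_of_allSatisfy (by decide) hcs allSatisfy_twoCycles
  exact Bool.false_ne_true he

end NineVertices

section Graphs

variable {V : Type*} {G : SimpleGraph V}

/-- The graph obtained from `G` by attaching vertices of degree one, indexed by `ι`, to `u`. -/
def attachPendants {V : Type*} (G : SimpleGraph V) (u : V) (ι : Type*) : SimpleGraph (V ⊕ ι) where
  Adj
    | .inl a, .inl b => G.Adj a b
    | .inl a, .inr _ => a = u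
    | .inr _, .inl b => b = u
    | .inr _, .inr _ => False
  symm := ⟨by rintro (a | i) (b | j) h; exacts [h.symm, h, h, h]⟩
  loopless := ⟨by rintro (a | i) h; exacts [G.loopless.irrefl a h, h]⟩

theorem attachPendants_connected (hG : G.Connected) (u : V) (ι : Type*) :
    (attachPendants G u ι).Connected := by
  let f : G ↪g attachPendants G u ι := ⟨Function.Embedding.inl, Iff.rfl⟩
  refine (connected_iff_exists_forall_reachable _).2 ⟨.inl u, ?_⟩
  rintro (v | i)
  · exact (hG.preconnected u v).map f.toHom
  · exact Adj.reachable (G := attachPendants G u ι) (rfl : u = u)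

theorem NoIsolatingVertex.attachPendants (h : NoIsolatingVertex G) (u : V) (ι : Type*) :
    NoIsolatingVertex (attachPendants G u ι) := by
  let f : G ↪g _root_.attachPendants G u ι := ⟨Function.Embedding.inl, Iff.rfl⟩
  rintro (v | i)
  · obtain ⟨a, b, c, d, hc, ha, hb, hcc, hd⟩ := h v
    exact ⟨_, _, _, _, hc.map f, ha.map f, hb.map f, hcc.map f, hd.map f⟩
  · obtain ⟨a, b, c, d, hc, ha, hb, hcc, hd⟩ := h u
    have key : ∀ x, Avoids G u x → Avoids (_root_.attachPendants G u ι) (.inr i) (f x) :=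
      fun x hx => ⟨Sum.inr_ne_inl, fun h : x = u => hx.1 h.symm⟩
    exact ⟨_, _, _, _, hc.map f, key a ha, key b hb, key c hcc, key d hd⟩

theorem noIsolatingVertex_of_isolNum (h : ¬ isolNum C4 G ≤ 1) : NoIsolatingVertex G := by
  intro v
  have hv : HasCopy C4 (G.induce (closedNbhd G {v})ᶜ) := by
    by_contra hv
    exact h (Nat.sInf_le ⟨{v}, Set.ncard_singleton v, hv⟩)
  obtain ⟨f, hf⟩ := hv
  have hav : ∀ i, Avoids G v (f i) := fun i =>
    ⟨fun h => (f i).2 (Or.inl h.symm), fun h => (f i).2 (Or.inr ⟨v, rfl, h⟩)⟩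
  have hne : ∀ {i j}, i ≠ j → (f i : V) ≠ f j := fun hij =>
    Subtype.val_injective.ne (f.injective.ne hij)
  have hadj : ∀ i : Fin 4, G.Adj (f i) (f (i + 1)) := fun i =>
    hf (by revert i; simp [C4, cycleGraph_adj])
  exact ⟨f 0, f 1, f 2, f 3, ⟨hadj 0, hadj 1, hadj 2, hadj 3, hne (by decide), hne (by decide)⟩,
    hav 0, hav 1, hav 2, hav 3⟩

variable [Fintype V]

theorem exists_equiv_of_nodup (hV : Fintype.card V = 9) {l : List V} (hl : l.Nodup)
    (h9 : l.length = 9) : ∃ e : Fin 9 ≃ V, ∀ i : Fin 9, e i = l.get (i.cast h9.symm) := by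
  have hinj : Function.Injective fun i : Fin 9 => l.get (i.cast h9.symm) :=
    hl.injective_get.comp (Fin.cast_injective _)
  exact ⟨Equiv.ofBijective _ ((Fintype.bijective_iff_injective_and_card _).2 ⟨hinj, by simp [hV]⟩),
    fun _ => rfl⟩

theorem exists_labelling (hV : Fintype.card V = 9) (h : NoIsolatingVertex G) (hG : G.Connected)
    {l : List V} (hl : l.Nodup) (h9 : l.length = 9) :
    ∃ (H : SimpleGraph (Fin 9)) (f : H ≃g G), NoIsolatingVertex H ∧ H.Connected ∧
      ∀ i : Fin 9, f i = l.get (i.cast h9.symm) := by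
  obtain ⟨e, he⟩ := exists_equiv_of_nodup hV hl h9
  let f : G.comap e ≃g G := SimpleGraph.Iso.comap e G
  exact ⟨_, f, h.iso f.symm, f.connected_iff.2 hG, he⟩

theorem isExceptional_of_four_neighbors (hV : Fintype.card V = 9) (h : NoIsolatingVertex G)
    (hG : G.Connected) {v x₁ x₂ x₃ x₄ : V} (hx : [x₁, x₂, x₃, x₄].Nodup)
    (hv : ∀ x ∈ [x₁, x₂, x₃, x₄], G.Adj v x) : IsExceptional G := by
  classical
  have hnodup : ∀ a b c d x₁ x₂ x₃ x₄ : V, IsFourCycle G a b c d →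
      (∀ y ∈ [a, b, c, d], Avoids G v y) → [x₁, x₂, x₃, x₄].Nodup →
      (∀ x ∈ [x₁, x₂, x₃, x₄], G.Adj v x) →
      ([a, b, c, d] ++ ([x₁, x₂, x₃, x₄] ++ [v])).Nodup := by
    intro a b c d x₁ x₂ x₃ x₄ hc hy hx hv
    refine List.Nodup.append hc.nodup (List.Nodup.append hx (List.nodup_singleton v) ?_) ?_
    · intro y hy hyv
      rw [List.mem_singleton.1 hyv] at hy
      exact (hv v hy).ne rfl
    · intro y hyl hyr
      rcases List.mem_append.1 hyr with hyr | hyr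
      · exact (hy y hyl).2 (hv y hyr)
      · exact (hy y hyl).1 (List.mem_singleton.1 hyr).symm
  have key : ∀ a b c d x₁ x₂ x₃ x₄ : V, IsFourCycle G a b c d →
      (∀ y ∈ [a, b, c, d], Avoids G v y) → [x₁, x₂, x₃, x₄].Nodup →
      (∀ x ∈ [x₁, x₂, x₃, x₄], G.Adj v x) → G.Adj a x₁ → IsExceptional G := by
    intro a b c d x₁ x₂ x₃ x₄ hc hy hx hv hax
    have hl := hnodup a b c d x₁ x₂ x₃ x₄ hc hy hx hv
    obtain ⟨H, f, hH, -, hf⟩ := exists_labelling hV h hG hl rfl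
    refine (isExceptional_of_star hH ?_ ?_ ?_ ?_).of_iso f.symm
    · exact .of_map f (by rwa [hf, hf, hf, hf])
    · simp only [List.forall_mem_cons] at hy ⊢
      simp only [← f.map_adj_iff, hf]
      exact ⟨hy.1.2, hy.2.1.2, hy.2.2.1.2, hy.2.2.2.1.2, by simp⟩
    · simp only [List.forall_mem_cons] at hv ⊢
      simp only [← f.map_adj_iff, hf]
      exact ⟨hv.1, hv.2.1, hv.2.2.1, hv.2.2.2.1, by simp⟩
    · simp only [← f.map_adj_iff, hf]
      exact hax
  obtain ⟨a, b, c, d, hc, hva, hvb, hvc, hvd⟩ := h v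
  have hxv : ∀ y, y = v ∨ y ∈ [a, b, c, d] ∨ y ∈ [x₁, x₂, x₃, x₄] := by
    have hl : ([a, b, c, d] ++ ([x₁, x₂, x₃, x₄] ++ [v])).Nodup := hnodup _ _ _ _ _ _ _ _ hc
      (by simp [hva, hvb, hvc, hvd]) hx hv
    obtain ⟨e, he⟩ := exists_equiv_of_nodup hV hl rfl
    intro y
    obtain ⟨i, rfl⟩ := e.surjective y
    have := he i ▸ List.get_mem ([a, b, c, d] ++ ([x₁, x₂, x₃, x₄] ++ [v])) (i.cast rfl)
    simp only [List.mem_append, List.mem_singleton] at this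
    tauto
  obtain ⟨p, hp, q, hq, hpq⟩ := exists_adj_of_connected hG (S := {y | y ∈ [a, b, c, d]})
    (x := a) (y := v) (by simp) (by simp [hva.1, hvb.1, hvc.1, hvd.1])
  have hcp : ∃ b' c' d', IsFourCycle G p b' c' d' ∧ ∀ y ∈ [p, b', c', d'], Avoids G v y := by
    simp only [List.mem_cons, List.not_mem_nil, or_false, Set.mem_ofPred_eq] at hp
    rcases hp with rfl | rfl | rfl | rfl
    · exact ⟨_, _, _, hc, by simp [hva, hvb, hvc, hvd]⟩
    · exact ⟨_, _, _, hc.rotate, by simp [hva, hvb, hvc, hvd]⟩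
    · exact ⟨_, _, _, hc.rotate.rotate, by simp [hva, hvb, hvc, hvd]⟩
    · exact ⟨_, _, _, hc.rotate.rotate.rotate, by simp [hva, hvb, hvc, hvd]⟩
  obtain ⟨b', c', d', hc', hy⟩ := hcp
  have hqv : q ≠ v := fun h => (hy p (by simp)).2 (h ▸ hpq).symm
  have hqx : q ∈ [x₁, x₂, x₃, x₄] := ((hxv q).resolve_left hqv).resolve_left hq
  have hperm := List.perm_cons_erase hqx
  obtain ⟨y₁, y₂, y₃, hyl⟩ := List.length_eq_three.1
    (show ([x₁, x₂, x₃, x₄].erase q).length = 3 by simp [List.length_erase_of_mem hqx])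
  rw [hyl] at hperm
  exact key p b' c' d' q y₁ y₂ y₃ hc' hy (hperm.nodup hx)
    (fun x hx => hv x (hperm.mem_iff.2 hx)) hpq

theorem false_of_no_four_neighbors (hV : Fintype.card V = 9) (h : NoIsolatingVertex G)
    (hG : G.Connected)
    (hd : ∀ v, ∀ l : List V, l.Nodup → (∀ x ∈ l, G.Adj v x) → l.length ≠ 4) : False := by
  obtain ⟨v⟩ := hG.nonempty
  obtain ⟨a, b, c, d, hc, -⟩ := h v
  obtain ⟨a', b', c', d', hc', ha, hb, hcc, hdd⟩ := h a
  have hne : ∀ p q r s, IsFourCycle G p q r s → Avoids G a p → Avoids G a q → Avoids G a s →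
      p ≠ a ∧ p ≠ b ∧ p ≠ c ∧ p ≠ d := by
    intro p q r s hp h1 h2 h3
    have hb : ∀ x, Avoids G a x → x ≠ b ∧ x ≠ d := fun x hx =>
      ⟨fun h => hx.2 (h ▸ hc.1), fun h => hx.2 (h ▸ hc.2.2.2.1.symm)⟩
    refine ⟨h1.1.symm, (hb p h1).1, ?_, (hb p h1).2⟩
    rintro rfl
    refine hd p [b, d, q, s] ?_ ?_ rfl
    · simp [hc.2.2.2.2.2, (hb q h2).1.symm, (hb q h2).2.symm, (hb s h3).1.symm, (hb s h3).2.symm,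
        hp.2.2.2.2.2]
    · simp [hc.2.1.symm, hc.2.2.1, hp.1, hp.2.2.2.1.symm]
  have hl : ([a, b, c, d] ++ [a', b', c', d']).Nodup := by
    refine List.Nodup.append hc.nodup hc'.nodup fun y hy hy' => ?_
    have : y ≠ a ∧ y ≠ b ∧ y ≠ c ∧ y ≠ d := by
      simp only [List.mem_cons, List.not_mem_nil, or_false] at hy'
      rcases hy' with rfl | rfl | rfl | rfl
      · exact hne _ _ _ _ hc' ha hb hdd
      · exact hne _ _ _ _ hc'.rotate hb hcc ha
      · exact hne _ _ _ _ hc'.rotate.rotate hcc hdd hb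
      · exact hne _ _ _ _ hc'.rotate.rotate.rotate hdd ha hcc
    simp_all
  obtain ⟨w, hw⟩ : ∃ w, w ∉ [a, b, c, d] ++ [a', b', c', d'] := by
    classical
    by_contra! hw
    have := Finset.card_le_card (fun x _ => List.mem_toFinset.2 (hw x) :
      (Finset.univ : Finset V) ⊆ _)
    have := this.trans (List.toFinset_card_le _)
    simp [hV] at this
  obtain ⟨H, f, hH, hHc, hf⟩ := exists_labelling hV h hG (hl.concat hw) rfl
  refine not_two_cycles hH hHc ?_ ?_ fun v l hl hv => ?_
  · exact .of_map f (by rwa [hf, hf, hf, hf])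
  · exact .of_map f (by rwa [hf, hf, hf, hf])
  · rw [← l.length_map f]
    refine hd (f v) (l.map f) (hl.map f.injective) fun x hx => ?_
    obtain ⟨y, hy, rfl⟩ := List.mem_map.1 hx
    exact f.map_adj_iff.2 (hv y hy)

theorem isExceptional_of_card_eq_nine (hV : Fintype.card V = 9) (h : NoIsolatingVertex G)
    (hG : G.Connected) : IsExceptional G := by
  by_contra hn
  refine false_of_no_four_neighbors hV h hG fun v l hl hv h4 => hn ?_
  match l, h4 with
  | [_, _, _, _], _ => exact isExceptional_of_four_neighbors hV h hG hl hv

theorem not_noIsolatingVertex_of_card_lt (hn : Fintype.card V < 9) (hG : G.Connected) :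
    ¬ NoIsolatingVertex G := by
  intro h
  obtain ⟨u⟩ := hG.nonempty
  obtain ⟨X, -, hX, ⟨f⟩⟩ := isExceptional_of_card_eq_nine
    (G := attachPendants G u (Fin (9 - Fintype.card V))) (by simp; omega)
    (h.attachPendants u _) (attachPendants_connected hG u _)
  have hadj : ∀ x, X.Adj (f (.inr ⟨0, by omega⟩)) x → x = f (.inl u) := by
    intro x hx
    obtain ⟨y | i, rfl⟩ := f.surjective x
    · have : y = u := f.map_adj_iff.1 hx
      rw [this]
    · exact (f.map_adj_iff.1 hx : False).elim
  obtain ⟨x, y, hxy, hx, hy⟩ := hX (f (.inr ⟨0, by omega⟩))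
  exact hxy ((hadj x hx).trans (hadj y hy).symm)

end Graphs

/-- If `n ≤ 9` and `G` is a connected `n`-vertex graph that is not an `ℰ₄`-graph, then
`ι(G, C₄) ≤ 1`. -/
theorem stmt9 {V : Type*} [Fintype V] (G : SimpleGraph V)
    (hn : Fintype.card V ≤ 9) (hG : G.Connected)
    (hE : ∀ H ∈ calE4, ¬ Nonempty (G ≃g H.2)) :
    isolNum C4 G ≤ 1 := by
  by_contra h
  have hbad := noIsolatingVertex_of_isolNum h
  rcases hn.lt_or_eq with hn | hn
  · exact not_noIsolatingVertex_of_card_lt hn hG hbad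
  · obtain ⟨X, hX, -, hGX⟩ := isExceptional_of_card_eq_nine hn hbad hG
    exact hE _ (Or.inr hX) hGX
end
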